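/- Let p be odd and let G be a finite p-group of order p^n, n > 4, containing a cyclic subgroup of index p^2, and suppose G is not metacyclic. Then G/G' is not cyclic and there is a normal subgroup A with G/A cyclic and |A| = p^3; consequently |G'| divides p^2. -/

import Mathlib

/-- A group is metacyclic if it has a cyclic normal subgroup with cyclic
quotient. -/
def IsMetacyclic (G : Type*) [Group G] : Prop :=
  ∃ N : Subgroup G, ∃ h : N.Normal, IsCyclic N ∧ (letI := h; IsCyclic (G ⧸ N))

open scoped commutatorElement

/-- Power formula for a product of two elements whose commutator commutes with both. -/
lemma mul_pow_of_commute_commutator {G : Type*} [Group G] {x y k : G} (h : y * x = k * (x * y))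
    (hx : Commute k x) (hy : Commute k y) (n : ℕ) :
    (x * y) ^ n = k ^ n.choose 2 * (x ^ n * y ^ n) := by
  have key : ∀ n : ℕ, y ^ n * x = k ^ n * (x * y ^ n) := by
    intro n
    induction n with
    | zero => simp
    | succ n ih =>
      calc y ^ (n + 1) * x = y ^ n * (y * x) := by group
        _ = y ^ n * k * (x * y) := by rw [h]; group
        _ = k * (y ^ n * x) * y := by rw [← (hy.pow_right n).eq]; group
        _ = _ := by rw [ih]; group
  induction n with
  | zero => simp
  | succ n ih =>
    calc (x * y) ^ (n + 1) = k ^ n.choose 2 * x ^ n * (y ^ n * x) * y := by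
          rw [pow_succ, ih]; group
      _ = k ^ n.choose 2 * (x ^ n * k ^ n) * x * y ^ n * y := by rw [key]; group
      _ = _ := by
        rw [← ((hx.pow_left n).pow_right n).eq, Nat.choose_succ_succ' n 1, Nat.choose_one_right,
          add_comm n, pow_add, pow_succ x, pow_succ y]
        simp only [mul_assoc]

lemma mul_pow_prime_of_commute_commutator {G : Type*} [Group G] {p : ℕ} (hp : p.Prime)
    (hp2 : 2 < p) {x y k : G} (h : y * x = k * (x * y)) (hx : Commute k x) (hy : Commute k y)
    (hk : k ^ p = 1) : (x * y) ^ p = x ^ p * y ^ p := by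
  obtain ⟨t, ht⟩ := hp.dvd_choose_self two_ne_zero hp2
  rw [mul_pow_of_commute_commutator h hx hy, ht, pow_mul, hk, one_pow, one_mul]

/-- The `p`-th power map of a group whose commutators are central of exponent dividing `p`. -/
def powPrimeHom {G : Type*} [Group G] {p : ℕ} (hp : p.Prime) (hp2 : 2 < p)
    (hc : ∀ x y : G, ⁅x, y⁆ ∈ Subgroup.center G) (hk : ∀ x y : G, ⁅x, y⁆ ^ p = 1) : G →* G where
  toFun x := x ^ p
  map_one' := one_pow p
  map_mul' x y := mul_pow_prime_of_commute_commutator hp hp2 (k := ⁅y, x⁆)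
    (by simp [commutatorElement_def])
    ((Subgroup.mem_center_iff.1 (hc y x) x).symm) ((Subgroup.mem_center_iff.1 (hc y x) y).symm)
    (hk y x)

lemma commutator_le_of_closure {G : Type*} [Group G] {D : Subgroup G} [D.Normal] {S : Set G}
    (hS : Subgroup.closure S = ⊤) (h : ∀ x ∈ S, ∀ y ∈ S, ⁅x, y⁆ ∈ D) : commutator G ≤ D := by
  have hcomm : ∀ x y : G, ⁅x, y⁆ ∈ D ↔ Commute (x : G ⧸ D) (y : G ⧸ D) := by
    intro x y
    rw [← QuotientGroup.eq_one_iff, ← commutatorElement_eq_one_iff_commute]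
    rfl
  have h1 : ∀ x ∈ S, ∀ y, ⁅x, y⁆ ∈ D := by
    intro x hx y
    have : Subgroup.closure S ≤
        (Subgroup.centralizer {(x : G ⧸ D)}).comap (QuotientGroup.mk' D) := by
      rw [Subgroup.closure_le]
      intro y hy
      exact Subgroup.mem_centralizer_singleton_iff.2 ((hcomm x y).1 (h x hx y hy)).symm
    rw [hS] at this
    exact (hcomm x y).2
      (Subgroup.mem_centralizer_singleton_iff.1 (this (Subgroup.mem_top y))).symm
  have h2 : Subgroup.closure S ≤ (Subgroup.center (G ⧸ D)).comap (QuotientGroup.mk' D) := by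
    rw [Subgroup.closure_le]
    intro x hx
    refine Subgroup.mem_center_iff.2 fun y => ?_
    obtain ⟨y, rfl⟩ := QuotientGroup.mk_surjective y
    exact ((hcomm x y).1 (h1 x hx y)).symm
  rw [hS] at h2
  rw [commutator_def, Subgroup.commutator_le]
  intro x _ y _
  exact (hcomm x y).2 (Subgroup.mem_center_iff.1 (h2 (Subgroup.mem_top x)) y).symm

lemma exists_normal_index_eq_prime {G : Type*} [Group G] [Finite G] {p n : ℕ} (hp : p.Prime)
    (hG : Nat.card G = p ^ n) {H : Subgroup G} (hH : H ≠ ⊤) :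
    ∃ K : Subgroup G, K.Normal ∧ H ≤ K ∧ K.index = p := by
  have := Fact.mk hp
  obtain ⟨k, hk⟩ := IsPGroup.iff_card.1 ((IsPGroup.of_card hG).to_subgroup H)
  have hkn : k < n := by
    by_contra! hle
    apply hH
    apply Subgroup.eq_top_of_le_card
    rw [hG, hk]
    exact Nat.pow_le_pow_right hp.pos hle
  obtain ⟨m, rfl⟩ : ∃ m, n = m + 1 := ⟨n - 1, by omega⟩
  obtain ⟨K, hK, hHK⟩ := Sylow.exists_subgroup_card_pow_prime_le (p := p) (m := m)
    (hG ▸ pow_dvd_pow p (Nat.le_succ m)) H hk (by omega)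
  have hi : K.index = p := by
    have := K.card_mul_index
    rw [hK, hG, pow_succ] at this
    exact Nat.eq_of_mul_eq_mul_left (pow_pos hp.pos m) this
  refine ⟨K, Subgroup.normal_of_index_eq_minFac_card ?_, hHK, hi⟩
  rw [hi, hG, hp.pow_minFac (by omega)]

lemma isCyclic_of_isCyclic_quotient_commutator {G : Type*} [Group G] [Finite G] {p n : ℕ}
    (hp : p.Prime) (hG : Nat.card G = p ^ n) (h : IsCyclic (G ⧸ commutator G)) : IsCyclic G := by
  have := Fact.mk hp
  obtain ⟨g, hg⟩ := h.exists_generator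
  obtain ⟨g, rfl⟩ := QuotientGroup.mk_surjective g
  by_contra hnc
  have hne : Subgroup.zpowers g ≠ ⊤ := fun ht =>
    hnc ⟨g, (Subgroup.eq_top_iff' _).1 ht⟩
  obtain ⟨K, hKn, hgK, hKi⟩ := exists_normal_index_eq_prime hp hG hne
  have hcomm : commutator G ≤ K := by
    apply Subgroup.Normal.quotient_commutative_iff_commutator_le.1
    have : IsCyclic (G ⧸ K) := isCyclic_of_prime_card (p := p) hKi
    exact IsCyclic.isMulCommutative
  have : K = ⊤ := by
    rw [eq_top_iff]
    intro x _
    obtain ⟨j, hj⟩ := hg x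
    have h1 : (g ^ j)⁻¹ * x ∈ K := hcomm (QuotientGroup.eq.1 hj)
    have h2 : g ^ j ∈ K := hgK ⟨j, rfl⟩
    simpa using K.mul_mem h2 h1
  rw [this, Subgroup.index_top] at hKi
  exact hp.one_lt.ne hKi

lemma le_center_of_card_eq_prime {G : Type*} [Group G] [Finite G] {p : ℕ} (hp : p.Prime)
    (hG : IsPGroup p G) {N : Subgroup G} [N.Normal] (hN : Nat.card N = p) :
    N ≤ Subgroup.center G := by
  have := Fact.mk hp
  have hG' : IsPGroup p (ConjAct G) := hG
  obtain ⟨b, hb, hb1⟩ := hG'.exists_fixed_point_of_prime_dvd_card_of_fixed_point N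
    (dvd_of_eq hN.symm) (a := 1) (fun g => smul_one g)
  have hbc : (b : G) ∈ Subgroup.center G := by
    rw [Subgroup.mem_center_iff]
    intro g
    have := congrArg Subtype.val (hb (ConjAct.toConjAct g))
    rw [ConjAct.Subgroup.val_conj_smul, ConjAct.toConjAct_smul] at this
    exact mul_inv_eq_iff_eq_mul.1 this
  have hz := zpowers_eq_top_of_prime_card hN hb1.symm
  intro x hx
  obtain ⟨j, hj⟩ : (⟨x, hx⟩ : N) ∈ Subgroup.zpowers b := hz ▸ Subgroup.mem_top _
  have : x = (b : G) ^ j := by simpa using (congrArg Subtype.val hj).symm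
  exact this ▸ zpow_mem hbc j

lemma prime_pow_dvd_sub_one {p : ℕ} (hp : p.Prime) (hp2 : 2 < p) {m : ℕ} {r : ℤ}
    (h : (p : ℤ) ^ (m + 1) ∣ r ^ p - 1) : (p : ℤ) ^ m ∣ r - 1 := by
  have := Fact.mk hp
  have h1 : (p : ℤ) ∣ r ^ p - 1 := (dvd_pow_self _ (Nat.succ_ne_zero m)).trans h
  have h2 : (p : ℤ) ∣ r - 1 := by
    rw [← ZMod.intCast_zmod_eq_zero_iff_dvd] at h1 ⊢
    push_cast at h1 ⊢
    rwa [ZMod.pow_card] at h1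
  have h3 : ¬ (p : ℤ) ∣ r := by
    intro hr
    have := dvd_sub hr h2
    rw [sub_sub_cancel] at this
    exact hp.one_lt.ne' (by exact_mod_cast Int.eq_one_of_dvd_one (by positivity) this)
  have h4 := Int.emultiplicity_pow_sub_pow hp (hp.odd_of_ne_two hp2.ne') (x := r) (y := 1) h2 h3 p
  rw [one_pow] at h4
  rw [hp.emultiplicity_self] at h4
  have h6 := le_emultiplicity_of_pow_dvd h
  rw [h4] at h6
  apply pow_dvd_of_le_emultiplicity
  push_cast at h6
  exact (ENat.add_le_add_iff_right (by simp)).1 h6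

lemma mem_of_zpow_mem {G : Type*} [Group G] {p s : ℕ} (hp : p.Prime) {K : Subgroup G} {g : G}
    (hg : g ^ p ^ s = 1) {i : ℤ} (hi : ¬ (p : ℤ) ∣ i) (h : g ^ i ∈ K) : g ∈ K := by
  have hcop : IsCoprime i ((p : ℤ) ^ s) :=
    ((Nat.prime_iff_prime_int.1 hp).coprime_iff_not_dvd.2 hi).symm.pow_right
  obtain ⟨u, v, huv⟩ := hcop
  have : g = (g ^ i) ^ u := by
    have hg' : g ^ ((p : ℤ) ^ s) = 1 := by exact_mod_cast hg
    calc g = g ^ (u * i + v * (p : ℤ) ^ s) := by rw [huv, zpow_one]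
      _ = _ := by rw [zpow_add, mul_comm v, zpow_mul g _ v, hg', one_zpow, mul_one, mul_comm,
        zpow_mul]
  rw [this]
  exact zpow_mem h u

lemma eq_of_card_prime_pow_succ {G : Type*} [Group G] [Finite G] {p i : ℕ} (hp : p.Prime)
    {H K E : Subgroup G} (hH : Nat.card H = p ^ i) (hE : Nat.card E = p ^ (i + 1)) (hHK : H ≤ K)
    (hKE : K ≤ E) {a : G} (haK : a ∈ K) (haH : a ∉ H) : K = E := by
  obtain ⟨j, hj, hKj⟩ := (Nat.dvd_prime_pow hp).1 (hE ▸ Subgroup.card_dvd_of_le hKE)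
  apply Subgroup.eq_of_le_of_card_ge hKE
  rw [hE, hKj]
  apply Nat.pow_le_pow_right hp.pos
  by_contra! hlt
  apply haH
  rw [Subgroup.eq_of_le_of_card_ge hHK]
  · exact haK
  · rw [hKj, hH]
    exact Nat.pow_le_pow_right hp.pos (by omega)

lemma normal_of_le_center {G : Type*} [Group G] {H : Subgroup G} (h : H ≤ Subgroup.center G) :
    H.Normal where
  conj_mem x hx g := by rwa [Subgroup.mem_center_iff.1 (h hx) g, mul_inv_cancel_right]

lemma normal_of_commutator_le {G : Type*} [Group G] {H : Subgroup G} (h : commutator G ≤ H) :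
    H.Normal where
  conj_mem x hx g := by
    have h1 : ⁅g, x⁆ ∈ H :=
      h (Subgroup.commutator_mem_commutator (Subgroup.mem_top g) (Subgroup.mem_top x))
    simpa [commutatorElement_def] using H.mul_mem h1 hx

lemma isCyclic_quotient_of_sup_zpowers {G : Type*} [Group G] {N : Subgroup G} [N.Normal] {y : G}
    (h : N ⊔ Subgroup.zpowers y = ⊤) : IsCyclic (G ⧸ N) := by
  refine ⟨(y : G ⧸ N), ?_⟩
  refine (Subgroup.eq_top_iff' (Subgroup.zpowers (y : G ⧸ N))).1 ?_
  rw [eq_top_iff,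
    ← Subgroup.map_top_of_surjective _ (QuotientGroup.mk'_surjective N), ← h, Subgroup.map_sup,
    QuotientGroup.map_mk'_self, bot_sup_eq, MonoidHom.map_zpowers]
  rfl

/-- A noncyclic `p`-group, `p` odd, with a cyclic subgroup of index `p` is generated by a generator
of that subgroup and an element of order `p`, whose commutator has order dividing `p`. -/
lemma exists_generator_of_cyclic_index_prime {M : Type*} [Group M] [Finite M] {p m : ℕ}
    (hp : p.Prime) (hp2 : 2 < p) (hM : Nat.card M = p ^ (m + 3)) {c : M}
    (hc : orderOf c = p ^ (m + 2)) (hnc : ¬ IsCyclic M) :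
    ∃ e, e ∉ Subgroup.zpowers c ∧ e ^ p = 1 ∧ ⁅e, c⁆ ∈ Subgroup.zpowers (c ^ p ^ (m + 1)) ∧
      Subgroup.zpowers c ⊔ Subgroup.zpowers e = ⊤ := by
  have hcard : Nat.card (Subgroup.zpowers c) = p ^ (m + 2) := by rw [Nat.card_zpowers, hc]
  have hcz : ∀ i : ℤ, c ^ i = 1 ↔ (p : ℤ) ^ (m + 2) ∣ i := by
    intro i
    rw [← orderOf_dvd_iff_zpow_eq_one, hc]
    push_cast
    rfl
  have hgen : ∀ e ∉ Subgroup.zpowers c, Subgroup.zpowers c ⊔ Subgroup.zpowers e = ⊤ :=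
    fun e he => eq_of_card_prime_pow_succ hp hcard (by rw [Subgroup.card_top, hM]) le_sup_left
      le_top (Subgroup.mem_sup_right (Subgroup.mem_zpowers e)) he
  have hne : Subgroup.zpowers c ≠ ⊤ := fun ht => hnc ⟨c, (Subgroup.eq_top_iff' _).1 ht⟩
  obtain ⟨a, ha⟩ : ∃ a, a ∉ Subgroup.zpowers c := by
    by_contra! h
    exact hne ((Subgroup.eq_top_iff' _).2 h)
  obtain ⟨K, hKn, hcK, hKi⟩ := exists_normal_index_eq_prime hp hM hne
  have hK : Subgroup.zpowers c = K := by
    apply Subgroup.eq_of_le_of_card_ge hcK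
    have := K.card_mul_index
    rw [hKi, hM, pow_succ] at this
    rw [hcard, Nat.eq_of_mul_eq_mul_right hp.pos this]
  rw [← hK] at hKn hKi
  obtain ⟨t, ht⟩ := hKi ▸ (Subgroup.zpowers c).pow_index_mem a
  obtain ⟨r, hr⟩ := hKn.conj_mem c (Subgroup.mem_zpowers c) a
  simp only at ht hr
  have hpt : (p : ℤ) ∣ t := by
    by_contra hpt
    have h1 : c ∈ Subgroup.zpowers a :=
      mem_of_zpow_mem hp (hc ▸ pow_orderOf_eq_one c) hpt (ht ▸ pow_mem (Subgroup.mem_zpowers a) p)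
    have h2 := hgen a ha
    rw [sup_eq_right.2 ((Subgroup.zpowers_le).2 h1)] at h2
    exact hnc ⟨a, (Subgroup.eq_top_iff' _).1 h2⟩
  obtain ⟨s, rfl⟩ := hpt
  have hconj : ∀ k : ℕ, a ^ k * c * (a ^ k)⁻¹ = c ^ (r ^ k) := by
    intro k
    induction k with
    | zero => simp
    | succ k ih =>
      calc a ^ (k + 1) * c * (a ^ (k + 1))⁻¹ = a * (a ^ k * c * (a ^ k)⁻¹) * a⁻¹ := by
            rw [pow_succ']; group
        _ = _ := by rw [ih, ← conj_zpow, ← hr, ← zpow_mul, pow_succ']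
  have hrp : (p : ℤ) ^ (m + 2) ∣ r ^ p - 1 := by
    rw [← hcz, zpow_sub, ← hconj, ← ht, zpow_one, mul_inv_eq_one, mul_inv_eq_iff_eq_mul]
    exact ((Commute.refl c).zpow_left _).eq
  obtain ⟨j, hj⟩ := prime_pow_dvd_sub_one hp hp2 hrp
  have hz : ∀ i : ℤ, c ^ (i * (r - 1)) = (c ^ p ^ (m + 1)) ^ (j * i) := by
    intro i
    rw [hj, ← zpow_natCast, ← zpow_mul]
    push_cast
    ring_nf
  have hac : ∀ i : ℤ, a * c ^ i * a⁻¹ = c ^ (i * (r - 1)) * c ^ i := by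
    intro i
    rw [← conj_zpow, ← hr, ← zpow_mul, ← zpow_add]
    ring_nf
  refine ⟨a * c ^ (-s), ?_, ?_, ?_, ?_⟩
  · intro h
    exact ha ((Subgroup.mul_mem_cancel_right _ (zpow_mem (Subgroup.mem_zpowers c) (-s))).1 h)
  · have hk : c ^ (-s) * a = c ^ (s * (r - 1)) * (a * c ^ (-s)) := by
      have := hac (-s)
      rw [mul_inv_eq_iff_eq_mul] at this
      rw [this, ← mul_assoc, ← mul_assoc, ← zpow_add]
      simp
    rw [mul_pow_prime_of_commute_commutator hp hp2 hk, ← ht, ← zpow_natCast, ← zpow_mul,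
      ← zpow_add]
    · ring_nf
      simp
    · show _ * _ = _ * _
      have := hac (s * (r - 1))
      rw [mul_inv_eq_iff_eq_mul] at this
      rw [this, (hcz (s * (r - 1) * (r - 1))).2, one_mul]
      rw [hj]
      exact ⟨s * j * j * p ^ m, by ring⟩
    · exact (Commute.refl c).zpow_zpow _ _
    · rw [← zpow_natCast, ← zpow_mul, hcz, hj]
      exact ⟨s * j, by ring⟩
  · refine ⟨j, ?_⟩
    have h1 := hac 1
    have h2 := hz 1
    simp only [one_mul, mul_one, zpow_one] at h1 h2
    simp only [commutatorElement_def, ← h2]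
    calc c ^ (r - 1) = (a * c * a⁻¹) * c⁻¹ := by rw [h1]; group
      _ = _ := by group
  · apply hgen
    intro h
    exact ha ((Subgroup.mul_mem_cancel_right _ (zpow_mem (Subgroup.mem_zpowers c) (-s))).1 h)

/-- The `p`-th power map is an endomorphism of such a group, its kernel has order `p ^ 2`. -/
lemma exists_powHom_of_cyclic_index_prime {M : Type*} [Group M] [Finite M] {p m : ℕ}
    (hp : p.Prime) (hp2 : 2 < p) (hM : Nat.card M = p ^ (m + 3)) {c : M}
    (hc : orderOf c = p ^ (m + 2)) (hnc : ¬ IsCyclic M) :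
    ∃ φ : M →* M, (∀ x, φ x = x ^ p) ∧ Nat.card φ.ker = p ^ 2 ∧
      Subgroup.zpowers c ⊔ φ.ker = ⊤ ∧
      Subgroup.zpowers (c ^ p ^ (m + 1)) ≤ Subgroup.center M ∧
      commutator M ≤ Subgroup.zpowers (c ^ p ^ (m + 1)) := by
  obtain ⟨e, hec, hep, hcomm, htop⟩ := exists_generator_of_cyclic_index_prime hp hp2 hM hc hnc
  set z := c ^ p ^ (m + 1) with hzdef
  have hzp : z ^ p = 1 := by
    rw [hzdef, ← pow_mul, ← pow_succ, ← hc, pow_orderOf_eq_one]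
  have hze : Commute e z := by
    obtain ⟨j, hj⟩ := hcomm
    have h1 : e * c * e⁻¹ = z ^ j * c := by
      simp only at hj
      rw [hj, commutatorElement_def]
      group
    have hzc : Commute (z ^ j) c := ((Commute.refl c).pow_left _).zpow_left _
    have h2 : e * z * e⁻¹ = z := by
      have hz0 : (z ^ j) ^ p ^ (m + 1) = 1 := by
        rw [pow_succ', pow_mul, ← zpow_natCast (z ^ j) p, zpow_comm, zpow_natCast, hzp]
        simp
      rw [hzdef, ← conj_pow, h1, hzc.mul_pow, hz0, one_mul]
    exact mul_inv_eq_iff_eq_mul.1 h2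
  have hcen : Subgroup.zpowers z ≤ Subgroup.center M := by
    rw [Subgroup.zpowers_le]
    have : (⊤ : Subgroup M) ≤ Subgroup.centralizer {z} := by
      rw [← htop, sup_le_iff, Subgroup.zpowers_le, Subgroup.zpowers_le]
      exact ⟨Subgroup.mem_centralizer_singleton_iff.2 ((Commute.refl c).pow_right _).eq,
        Subgroup.mem_centralizer_singleton_iff.2 hze.eq⟩
    exact Subgroup.mem_center_iff.2 fun g =>
      Subgroup.mem_centralizer_singleton_iff.1 (this (Subgroup.mem_top g))
  have hZn : (Subgroup.zpowers z).Normal := normal_of_le_center hcen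
  have hder : commutator M ≤ Subgroup.zpowers z := by
    apply commutator_le_of_closure (S := {c, e})
    · rw [Set.insert_eq, Subgroup.closure_union, ← Subgroup.zpowers_eq_closure,
        ← Subgroup.zpowers_eq_closure, htop]
    · rintro x (rfl | rfl) y (rfl | rfl)
      · simp
      · rw [← commutatorElement_inv]
        exact inv_mem hcomm
      · exact hcomm
      · simp
  have hel : ∀ x y : M, ⁅x, y⁆ ∈ Subgroup.zpowers z := fun x y =>
    hder (Subgroup.commutator_mem_commutator (Subgroup.mem_top x) (Subgroup.mem_top y))
  let φ := powPrimeHom hp hp2 (fun x y => hcen (hel x y)) (fun x y => by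
    obtain ⟨j, hj⟩ := hel x y
    rw [← hj]
    show (z ^ j) ^ p = 1
    rw [← zpow_natCast (z ^ j) p, zpow_comm, zpow_natCast, hzp, one_zpow])
  have hφ : ∀ x, φ x = x ^ p := fun _ => rfl
  have hsup : Subgroup.zpowers c ⊔ φ.ker = ⊤ := by
    rw [eq_top_iff, ← htop]
    refine sup_le_sup_left ?_ _
    rw [Subgroup.zpowers_le, MonoidHom.mem_ker, hφ, hep]
  refine ⟨φ, hφ, ?_, hsup, hcen, hder⟩
  have hrange : φ.range = Subgroup.zpowers (c ^ p) := by
    rw [MonoidHom.range_eq_map, ← hsup, Subgroup.map_sup, MonoidHom.map_zpowers, hφ,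
      (Subgroup.map_eq_bot_iff _).2 le_rfl, sup_bot_eq]
  have hrc : Nat.card φ.range = p ^ (m + 1) := by
    rw [hrange, Nat.card_zpowers]
    have := Fact.mk hp
    apply orderOf_eq_prime_pow
    · rw [← pow_mul, ← pow_succ', ← orderOf_dvd_iff_pow_eq_one, hc,
        Nat.pow_dvd_pow_iff_le_right hp.one_lt]
      omega
    · rw [← pow_mul, ← pow_succ', ← hc, pow_orderOf_eq_one]
  have := φ.ker.card_mul_index
  rw [Subgroup.index_ker, hrc, hM, show m + 3 = 2 + (m + 1) by omega, pow_add p 2] at this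
  exact Nat.eq_of_mul_eq_mul_right (pow_pos hp.pos _) this

lemma exists_normal_of_cyclic_index_prime {G : Type*} [Group G] [Finite G] {p m : ℕ}
    (hp : p.Prime) (hp2 : 2 < p) {M : Subgroup G} [hMn : M.Normal]
    (hM : Nat.card M = p ^ (m + 3)) {c : G} (hcM : c ∈ M) (hc : orderOf c = p ^ (m + 2))
    (hnc : ¬ IsCyclic M) :
    ∃ E : Subgroup G, E.Normal ∧ (∀ x, x ∈ E ↔ x ∈ M ∧ x ^ p = 1) ∧ Nat.card E = p ^ 2 ∧
      Subgroup.zpowers c ⊔ E = M ∧ (∀ x ∈ M, ∀ y ∈ M, (x * y) ^ p = x ^ p * y ^ p) ∧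
      (∀ x ∈ M, ∀ y ∈ M, ⁅x, y⁆ ∈ Subgroup.zpowers (c ^ p ^ (m + 1))) ∧
      ∀ x ∈ M, Commute x (c ^ p ^ (m + 1)) := by
  obtain ⟨φ, hφ, hker, hsup, hcen, hder⟩ := exists_powHom_of_cyclic_index_prime hp hp2 hM
    (c := ⟨c, hcM⟩) (by rw [← hc, Subgroup.orderOf_mk]) hnc
  have hmem : ∀ x, x ∈ φ.ker.map M.subtype ↔ x ∈ M ∧ x ^ p = 1 := by
    intro x
    simp only [Subgroup.mem_map, MonoidHom.mem_ker, hφ, Subgroup.subtype_apply, Subtype.exists]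
    constructor
    · rintro ⟨a, ha, h, rfl⟩
      exact ⟨ha, congrArg Subtype.val h⟩
    · rintro ⟨h1, h2⟩
      exact ⟨x, h1, Subtype.ext h2, rfl⟩
  refine ⟨φ.ker.map M.subtype, ⟨fun x hx g => ?_⟩, hmem, ?_, ?_, ?_, ?_, ?_⟩
  · rw [hmem] at hx ⊢
    exact ⟨hMn.conj_mem x hx.1 g, by rw [conj_pow, hx.2, mul_one, mul_inv_cancel]⟩
  · rw [Subgroup.card_map_of_injective M.subtype_injective, hker]
  · have := congrArg (Subgroup.map M.subtype) hsup
    rwa [Subgroup.map_sup, MonoidHom.map_zpowers, ← MonoidHom.range_eq_map,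
      Subgroup.range_subtype] at this
  · intro x hx y hy
    have := map_mul φ ⟨x, hx⟩ ⟨y, hy⟩
    simp only [hφ] at this
    exact congrArg Subtype.val this
  · intro x hx y hy
    obtain ⟨j, hj⟩ := hder (Subgroup.commutator_mem_commutator (Subgroup.mem_top (⟨x, hx⟩ : M))
      (Subgroup.mem_top ⟨y, hy⟩))
    exact ⟨j, congrArg Subtype.val hj⟩
  · intro x hx
    exact congrArg Subtype.val
      (Subgroup.mem_center_iff.1 (hcen (Subgroup.mem_zpowers _)) ⟨x, hx⟩)

/-- The remaining case: modulo the elements of order `p` of a maximal subgroup containing `c`,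
the group is modular. -/
lemma isMetacyclic_of_commutator_eq {G : Type*} [Group G] [Finite G] {p r : ℕ}
    (hp : p.Prime) (hp2 : 2 < p) (hG : Nat.card G = p ^ (r + 5)) {M E : Subgroup G} [M.Normal]
    [E.Normal] (hM : Nat.card M = p ^ (r + 4)) {c b : G} (hc : orderOf c = p ^ (r + 3))
    (hcM : c ∈ M) (hE : ∀ x, x ∈ E ↔ x ∈ M ∧ x ^ p = 1) (hEc : Nat.card E = p ^ 2)
    (hsup : Subgroup.zpowers c ⊔ E = M)
    (hpow : ∀ x ∈ M, ∀ y ∈ M, (x * y) ^ p = x ^ p * y ^ p)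
    (hzM : ∀ x ∈ M, Commute x (c ^ p ^ (r + 2)))
    (hbM : b ∉ M) (hbE : b ^ p ∈ E) {k : ℤ} (hk : ¬ (p : ℤ) ∣ k) {e : G} (he : e ∈ E)
    (hd : ⁅b, c⁆ = (c ^ p ^ (r + 1)) ^ k * e) : IsMetacyclic G := by
  have hEM : ∀ x ∈ E, x ∈ M := fun x hx => ((hE x).1 hx).1
  have hEp : ∀ x ∈ E, x ^ p = 1 := fun x hx => ((hE x).1 hx).2
  set z := c ^ p ^ (r + 2) with hzdef
  set w := c ^ p ^ (r + 1) with hwdef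
  set d := ⁅b, c⁆ with hddef
  have hwp : w ^ p = z := by rw [hwdef, ← pow_mul, ← pow_succ]
  have hzp : z ^ p = 1 := by rw [hzdef, ← pow_mul, ← pow_succ, ← hc, pow_orderOf_eq_one]
  have hzkp : ∀ i : ℤ, (z ^ i) ^ p = 1 := fun i => by
    rw [← zpow_natCast (z ^ i) p, zpow_comm, zpow_natCast, hzp, one_zpow]
  have hz1 : z ≠ 1 := by
    intro h
    rw [← orderOf_dvd_iff_pow_eq_one, hc, Nat.pow_dvd_pow_iff_le_right hp.one_lt] at h
    omega
  have hzord : orderOf z = p := by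
    have := Fact.mk hp
    exact orderOf_eq_prime hzp hz1
  have hwM : w ∈ M := pow_mem hcM _
  have hzmM : z ∈ M := pow_mem hcM _
  have hzE : z ∈ E := (hE z).2 ⟨hzmM, hzp⟩
  have hdM : d ∈ M := hd ▸ M.mul_mem (zpow_mem hwM k) (hEM e he)
  have hdp : d ^ p = z ^ k := by
    rw [hd, hpow _ (zpow_mem hwM k) _ (hEM e he), hEp e he, mul_one, ← zpow_natCast, zpow_comm,
      zpow_natCast, hwp]
  have hbc : b * c * b⁻¹ = d * c := by rw [hddef, commutatorElement_def]; group
  have hcz : Commute c z := (Commute.refl c).pow_right _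
  have hbcp : b * c ^ p * b⁻¹ = z ^ k * c ^ p := by
    rw [← conj_pow, hbc, hpow _ hdM _ hcM, hdp]
  have hbw : b * w * b⁻¹ = (z ^ k) ^ p ^ r * w := by
    have : w = (c ^ p) ^ p ^ r := by rw [hwdef, ← pow_mul, ← pow_succ']
    rw [this, ← conj_pow, hbcp, ((hcz.symm.zpow_left k).pow_right p).mul_pow]
  have hbz : Commute b z := by
    have : b * z * b⁻¹ = z := by
      rw [← hwp, ← conj_pow, hbw,
        hpow _ (pow_mem (zpow_mem hzmM k) _) _ hwM, ← pow_mul, mul_comm, pow_mul, hzkp, one_pow,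
        one_mul]
    exact mul_inv_eq_iff_eq_mul.1 this
  have hMb : ∀ L : Subgroup G, M ≤ L → b ∈ L → L = ⊤ := fun L h1 h2 =>
    eq_of_card_prime_pow_succ hp hM (by rw [Subgroup.card_top, hG]) h1 le_top h2 hbM
  have hgen : ∀ L : Subgroup G, c ∈ L → E ≤ L → b ∈ L → L = ⊤ := fun L h1 h2 h3 =>
    hMb L (hsup ▸ sup_le ((Subgroup.zpowers_le).2 h1) h2) h3
  have hzcen : Subgroup.zpowers z ≤ Subgroup.center G := by
    have : Subgroup.centralizer {z} = ⊤ := hMb _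
      (fun x hx => Subgroup.mem_centralizer_singleton_iff.2 (hzM x hx).eq)
      (Subgroup.mem_centralizer_singleton_iff.2 hbz.eq)
    rw [Subgroup.zpowers_le]
    exact Subgroup.mem_center_iff.2 fun g =>
      Subgroup.mem_centralizer_singleton_iff.1 (this ▸ Subgroup.mem_top g)
  set Z := Subgroup.zpowers z
  have hZn : Z.Normal := normal_of_le_center hzcen
  have hZp : ∀ q ∈ Z, q ^ p = 1 := by rintro q ⟨i, rfl⟩; exact hzkp i
  have hZE : Z ≤ E := (Subgroup.zpowers_le).2 hzE
  have hZcard : Nat.card Z = p := by rw [Nat.card_zpowers, hzord]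
  let π := QuotientGroup.mk' Z
  have hπ : ∀ x, π x = 1 ↔ x ∈ Z := fun x => QuotientGroup.eq_one_iff x
  have hπz : π z = 1 := (hπ z).2 (Subgroup.mem_zpowers z)
  have hπs : Function.Surjective π := QuotientGroup.mk'_surjective Z
  have hEcen : ∀ x ∈ E, π x ∈ Subgroup.center (G ⧸ Z) := by
    have hEn : (E.map π).Normal := Subgroup.Normal.map inferInstance π hπs
    have hcard : Nat.card (E.map π) = p := by
      have h1 := (π.domRestrict E).ker.card_mul_index
      rw [Subgroup.index_ker, MonoidHom.domRestrict_range, MonoidHom.ker_domRestrict,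
        QuotientGroup.ker_mk', Nat.card_congr (Subgroup.subgroupOfEquivOfLe hZE).toEquiv, hZcard,
        hEc, sq] at h1
      exact Nat.eq_of_mul_eq_mul_left hp.pos h1
    exact fun x hx => le_center_of_card_eq_prime hp ((IsPGroup.of_card hG).to_quotient Z) hcard
      (Subgroup.mem_map_of_mem π hx)
  have hπcen : ∀ x, Commute (π x) (π b) → Commute (π x) (π c) →
      π x ∈ Subgroup.center (G ⧸ Z) := by
    intro x h1 h2
    have : (Subgroup.centralizer {π x}).comap π = ⊤ := hgen _
      (Subgroup.mem_centralizer_singleton_iff.2 h2.symm.eq)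
      (fun y hy => Subgroup.mem_centralizer_singleton_iff.2
        (Subgroup.mem_center_iff.1 (hEcen y hy) _).symm)
      (Subgroup.mem_centralizer_singleton_iff.2 h1.symm.eq)
    refine Subgroup.mem_center_iff.2 fun g => ?_
    obtain ⟨g, rfl⟩ := hπs g
    exact Subgroup.mem_centralizer_singleton_iff.1
      ((this ▸ Subgroup.mem_top g : g ∈ (Subgroup.centralizer {π x}).comap π))
  have hdcen : π d ∈ Subgroup.center (G ⧸ Z) := by
    rw [hd, map_mul, map_zpow]
    refine mul_mem (zpow_mem (hπcen w ?_ ?_) k) (hEcen e he)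
    · have := congrArg π hbw
      rw [map_mul, map_mul, map_mul, map_pow π (z ^ k), map_zpow, hπz, one_zpow, one_pow, one_mul,
        map_inv] at this
      exact (mul_inv_eq_iff_eq_mul.1 this).symm
    · exact ((Commute.refl c).pow_left _).map π
  have hcomm_d : ∀ g : G, ⁅g, d⁆ ∈ Z := by
    intro g
    rw [← hπ, map_commutatorElement, commutatorElement_eq_one_iff_mul_comm]
    exact Subgroup.mem_center_iff.1 hdcen (π g)
  have hcb : c * b ^ p * c⁻¹ = z ^ (-k) * b ^ p := by
    have h1 : c * b * c⁻¹ = d⁻¹ * b := by rw [hddef, commutatorElement_def]; group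
    have h2 : ⁅b, d⁻¹⁆ ∈ Z := by
      rw [← hπ, map_commutatorElement, commutatorElement_eq_one_iff_mul_comm]
      exact Subgroup.mem_center_iff.1 (by rw [map_inv]; exact inv_mem hdcen) (π b)
    rw [← conj_pow, h1, mul_pow_prime_of_commute_commutator hp hp2 (k := ⁅b, d⁻¹⁆), inv_pow, hdp,
      zpow_neg]
    · rw [commutatorElement_def]; group
    · exact (Subgroup.mem_center_iff.1 (hzcen h2) _).symm
    · exact (Subgroup.mem_center_iff.1 (hzcen h2) _).symm
    · exact hZp _ h2
  have hbZ : b ^ p ∉ Z := by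
    intro h
    rw [Subgroup.mem_center_iff.1 (hzcen h) c, mul_inv_cancel_right, eq_comm, mul_eq_right,
      ← orderOf_dvd_iff_zpow_eq_one, hzord, dvd_neg] at hcb
    exact hk hcb
  have hEgen : Z ⊔ Subgroup.zpowers (b ^ p) = E :=
    eq_of_card_prime_pow_succ hp (by rw [hZcard, pow_one]) hEc le_sup_left
      (sup_le hZE ((Subgroup.zpowers_le).2 hbE)) (Subgroup.mem_sup_right (Subgroup.mem_zpowers _))
      hbZ
  obtain ⟨q, hq, y, ⟨i, rfl⟩, hqe⟩ := Subgroup.mem_sup_of_normal_left.1 (hEgen.symm ▸ he)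
  have hgen2 : ∀ L : Subgroup G, c ∈ L → b ∈ L → L = ⊤ := by
    intro L h1 h2
    refine hgen L h1 ?_ h2
    rw [← hEgen]
    exact sup_le ((Subgroup.zpowers_le).2 (pow_mem h1 _))
      ((Subgroup.zpowers_le).2 (pow_mem h2 p))
  set D := Subgroup.zpowers d
  have hzof : ∀ L : Subgroup G, z ^ k ∈ L → Z ≤ L := fun L h =>
    (Subgroup.zpowers_le).2 (mem_of_zpow_mem (s := 1) hp (by rwa [pow_one]) hk h)
  have hZD : Z ≤ D := hzof D (hdp ▸ pow_mem (Subgroup.mem_zpowers d) p)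
  have hDn : D.Normal := by
    refine ⟨?_⟩
    rintro _ ⟨j, rfl⟩ g
    have h1 : g * d * g⁻¹ = ⁅g, d⁆ * d := by rw [commutatorElement_def]; group
    show g * d ^ j * g⁻¹ ∈ D
    rw [← conj_zpow, h1]
    exact zpow_mem (D.mul_mem (hZD (hcomm_d g)) (Subgroup.mem_zpowers d)) j
  have hder : commutator G ≤ D := by
    apply commutator_le_of_closure (S := {b, c})
    · exact hgen2 _ (Subgroup.subset_closure (by simp)) (Subgroup.subset_closure (by simp))
    · rintro x (rfl | rfl) y (rfl | rfl)
      · simp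
      · exact Subgroup.mem_zpowers d
      · rw [← commutatorElement_inv]
        exact inv_mem (Subgroup.mem_zpowers d)
      · simp
  suffices ∃ x y, d ∈ Subgroup.zpowers x ∧ Subgroup.zpowers x ⊔ Subgroup.zpowers y = ⊤ by
    obtain ⟨x, y, hdx, hxy⟩ := this
    have hn := normal_of_commutator_le (hder.trans ((Subgroup.zpowers_le).2 hdx))
    exact ⟨Subgroup.zpowers x, hn, inferInstance, isCyclic_quotient_of_sup_zpowers hxy⟩
  by_cases hi : (p : ℤ) ∣ i
  · obtain ⟨i, rfl⟩ := hi
    refine ⟨c, b, ?_, hgen2 _ (Subgroup.mem_sup_left (Subgroup.mem_zpowers c))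
      (Subgroup.mem_sup_right (Subgroup.mem_zpowers b))⟩
    have h1 : (b ^ p) ^ ((p : ℤ) * i) = 1 := by
      rw [zpow_mul, zpow_natCast, hEp _ hbE, one_zpow]
    simp only [h1, mul_one] at hqe
    have hZc : Z ≤ Subgroup.zpowers c :=
      (Subgroup.zpowers_le).2 (pow_mem (Subgroup.mem_zpowers c) _)
    rw [hd, ← hqe]
    exact mul_mem (zpow_mem (pow_mem (Subgroup.mem_zpowers c) _) k) (hZc hq)
  · set x := b ^ i * (c ^ p ^ r) ^ k with hxdef
    have hQder : ∀ x y : G ⧸ Z, ⁅x, y⁆ ∈ Subgroup.zpowers (π d) := by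
      intro x y
      obtain ⟨x, rfl⟩ := hπs x
      obtain ⟨y, rfl⟩ := hπs y
      rw [← map_commutatorElement, ← MonoidHom.map_zpowers]
      exact Subgroup.mem_map_of_mem π (hder
        (Subgroup.commutator_mem_commutator (Subgroup.mem_top x) (Subgroup.mem_top y)))
    have hπdp : π d ^ p = 1 := by rw [← map_pow, hdp, map_zpow, hπz, one_zpow]
    let ψ := powPrimeHom (G := G ⧸ Z) hp hp2
      (fun x y => (Subgroup.zpowers_le).2 hdcen (hQder x y)) (fun x y => by
        obtain ⟨j, hj⟩ := hQder x y
        rw [← hj]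
        show (π d ^ j) ^ p = 1
        rw [← zpow_natCast (π d ^ j) p, zpow_comm, zpow_natCast, hπdp, one_zpow])
    have hψ : ∀ x, ψ x = x ^ p := fun _ => rfl
    have hxp : π (x ^ p) = π d := by
      have hπq : π q = 1 := (hπ q).2 hq
      have hw : (c ^ p ^ r) ^ p = w := by rw [hwdef, ← pow_mul, ← pow_succ]
      have hbi : π ((b ^ p) ^ i) = π e := by rw [← hqe, map_mul, hπq, one_mul]
      calc π (x ^ p) = ψ (π x) := by rw [hψ, map_pow]
        _ = π ((b ^ p) ^ i * w ^ k) := by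
          rw [hxdef, map_mul, map_mul, map_mul, map_zpow, map_zpow, map_zpow, map_zpow, hψ, hψ,
            ← map_pow, ← map_pow, hw, ← map_zpow, ← map_zpow]
        _ = π d := by
          rw [map_mul, hbi, hd, map_mul]
          exact (Subgroup.mem_center_iff.1 (hEcen e he) _).symm
    have hxd : (x ^ p)⁻¹ * d ∈ Z := by
      rw [← hπ, map_mul, map_inv, hxp, inv_mul_cancel]
    have hxdp : (x ^ p) ^ p = z ^ k := by
      have h1 : d = x ^ p * ((x ^ p)⁻¹ * d) := by group
      have h2 : Commute (x ^ p) ((x ^ p)⁻¹ * d) := Subgroup.mem_center_iff.1 (hzcen hxd) _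
      rw [← hdp, h1, h2.mul_pow, hZp _ hxd, mul_one]
    have hxx := Subgroup.mem_zpowers x
    have hZx : Z ≤ Subgroup.zpowers x := hzof _ (hxdp ▸ pow_mem (pow_mem hxx p) p)
    refine ⟨x, c, ?_, ?_⟩
    · have := mul_mem (pow_mem hxx p) (hZx hxd)
      rwa [mul_inv_cancel_left] at this
    · have hcK := Subgroup.mem_sup_right (S := Subgroup.zpowers x) (Subgroup.mem_zpowers c)
      refine hgen2 _ hcK ?_
      refine mem_of_zpow_mem (s := 2) hp (by rw [sq, pow_mul, hEp _ hbE]) hi ?_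
      have h1 := Subgroup.mem_sup_left (T := Subgroup.zpowers c) hxx
      rw [hxdef] at h1
      exact (Subgroup.mul_mem_cancel_right _ (zpow_mem (pow_mem hcK _) k)).1 h1

lemma exists_normal_card_of_surjective {G L : Type*} [Group G] [Finite G] [Group L] {p a l : ℕ}
    (hp : p.Prime) (hG : Nat.card G = p ^ (a + l)) (hL : Nat.card L = p ^ l) (hLc : IsCyclic L)
    (f : G →* L) (hf : Function.Surjective f) :
    ∃ A : Subgroup G, ∃ h : A.Normal, Nat.card A = p ^ a ∧ (letI := h; IsCyclic (G ⧸ A)) := by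
  refine ⟨f.ker, inferInstance, ?_, ?_⟩
  · have := f.ker.card_mul_index
    rw [Subgroup.index_ker, MonoidHom.range_eq_top.2 hf, Subgroup.card_top, hL, hG, pow_add] at this
    exact Nat.eq_of_mul_eq_mul_right (pow_pos hp.pos _) this
  · exact isCyclic_of_surjective _ (QuotientGroup.quotientKerEquivOfSurjective f hf).symm.surjective

lemma exists_normal_card_of_quotient {G : Type*} [Group G] [Finite G] {p a e l : ℕ}
    (hp : p.Prime) (hG : Nat.card G = p ^ (a + e + l)) {E : Subgroup G} [E.Normal]
    (hE : Nat.card E = p ^ a) {B : Subgroup (G ⧸ E)} [B.Normal] (hB : Nat.card B = p ^ e)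
    (hc : IsCyclic ((G ⧸ E) ⧸ B)) :
    ∃ A : Subgroup G, ∃ h : A.Normal, Nat.card A = p ^ (a + e) ∧
      (letI := h; IsCyclic (G ⧸ A)) := by
  refine exists_normal_card_of_surjective hp hG ?_ hc
    ((QuotientGroup.mk' B).comp (QuotientGroup.mk' E))
    ((QuotientGroup.mk'_surjective B).comp (QuotientGroup.mk'_surjective E))
  have h1 := E.card_eq_card_quotient_mul_card_subgroup
  have h2 := B.card_eq_card_quotient_mul_card_subgroup
  rw [h2, hG, hE, hB, mul_assoc, ← pow_add, add_comm e, pow_add p (a + e), mul_comm] at h1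
  exact (Nat.eq_of_mul_eq_mul_right (pow_pos hp.pos _) h1).symm

lemma exists_normal_card_prime_pow_three {G : Type*} [Group G] [Finite G] {p r : ℕ}
    (hp : p.Prime) (hp2 : 2 < p) (hG : Nat.card G = p ^ (r + 5)) {c : G}
    (hc : orderOf c = p ^ (r + 3)) (hnm : ¬ IsMetacyclic G) :
    ∃ A : Subgroup G, ∃ h : A.Normal, Nat.card A = p ^ 3 ∧ (letI := h; IsCyclic (G ⧸ A)) := by
  have := Fact.mk hp
  have hcG : Subgroup.zpowers c ≠ ⊤ := by
    intro h
    have := congrArg (fun H : Subgroup G => Nat.card H) h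
    simp only [Nat.card_zpowers, Subgroup.card_top, hc, hG] at this
    have := Nat.pow_right_injective hp.two_le this
    omega
  obtain ⟨M, hMn, hcM, hMi⟩ := exists_normal_index_eq_prime hp hG hcG
  rw [Subgroup.zpowers_le] at hcM
  have hM : Nat.card M = p ^ (r + 4) := by
    have := M.card_mul_index
    rw [hMi, hG, pow_succ] at this
    exact Nat.eq_of_mul_eq_mul_right hp.pos this
  have hMnc : ¬ IsCyclic M := fun h => hnm ⟨M, hMn, h, isCyclic_of_prime_card hMi⟩
  obtain ⟨E, hEn, hE, hEc, hsup, hpow, -, hzM⟩ :=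
    exists_normal_of_cyclic_index_prime hp hp2 (m := r + 1) hM hcM hc hMnc
  have hQ : Nat.card (G ⧸ E) = p ^ (r + 3) := by
    have h1 := E.card_eq_card_quotient_mul_card_subgroup
    rw [hG, hEc, pow_add p (r + 3) 2] at h1
    exact (Nat.eq_of_mul_eq_mul_right (pow_pos hp.pos _) h1).symm
  by_cases hQc : IsCyclic (G ⧸ E)
  · obtain ⟨B, hB⟩ := Sylow.exists_subgroup_card_pow_prime p (n := 1)
      (hQ ▸ pow_dvd_pow p (by omega) : p ^ 1 ∣ Nat.card (G ⧸ E))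
    have : IsMulCommutative (G ⧸ E) := IsCyclic.isMulCommutative
    have hBn : B.Normal := normal_of_commutator_le
      (((commutator_eq_bot_iff (G ⧸ E)).2 this).trans_le bot_le)
    exact exists_normal_card_of_quotient (l := r + 2) hp (by rw [hG]; ring_nf) hEc hB
      (isCyclic_of_surjective _ (QuotientGroup.mk'_surjective B))
  have hcE : ∀ i : ℕ, (c : G ⧸ E) ^ p ^ i = 1 ↔ r + 2 ≤ i := by
    intro i
    rw [← QuotientGroup.mk_pow, QuotientGroup.eq_one_iff, hE, ← pow_mul, ← pow_succ,
      ← orderOf_dvd_iff_pow_eq_one, hc, Nat.pow_dvd_pow_iff_le_right hp.one_lt]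
    exact ⟨fun h => by omega, fun h => ⟨pow_mem hcM _, by omega⟩⟩
  have hcQ : orderOf (c : G ⧸ E) = p ^ (r + 2) :=
    orderOf_eq_prime_pow (by rw [hcE]; omega) (by rw [hcE])
  obtain ⟨b, hbc, hbp, hcomm, htop⟩ := exists_generator_of_cyclic_index_prime hp hp2 hQ hcQ hQc
  by_cases hcb : ⁅b, (c : G ⧸ E)⁆ = 1
  · have hder : commutator (G ⧸ E) ≤ ⊥ := by
      apply commutator_le_of_closure (S := {(c : G ⧸ E), b})
      · rw [Set.insert_eq, Subgroup.closure_union, ← Subgroup.zpowers_eq_closure,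
          ← Subgroup.zpowers_eq_closure, htop]
      · rintro x (rfl | rfl) y (rfl | rfl)
        · simp
        · rw [← commutatorElement_inv, hcb]; simp
        · rw [hcb]; simp
        · simp
    have hBn : (Subgroup.zpowers b).Normal := normal_of_commutator_le (hder.trans bot_le)
    have hb1 : b ≠ 1 := by
      rintro rfl
      exact hbc (one_mem _)
    exact exists_normal_card_of_quotient (e := 1) (l := r + 2) hp (by rw [hG]; ring_nf) hEc
      (by rw [Nat.card_zpowers, orderOf_eq_prime hbp hb1, pow_one])
      (isCyclic_quotient_of_sup_zpowers (by rw [sup_comm, htop]))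
  obtain ⟨b, rfl⟩ := QuotientGroup.mk_surjective b
  obtain ⟨k, hk⟩ := hcomm
  have hd : ((c ^ p ^ (r + 1)) ^ k)⁻¹ * ⁅b, c⁆ ∈ E := QuotientGroup.eq.1 hk
  refine absurd (isMetacyclic_of_commutator_eq hp hp2 hG hM hc hcM hE hEc hsup hpow hzM (b := b)
    ?_ ?_ (k := k) ?_ hd (by rw [mul_inv_cancel_left])) hnm
  · intro h
    rw [← hsup] at h
    obtain ⟨y, hy, z, hz, rfl⟩ := Subgroup.mem_sup_of_normal_right.1 h
    apply hbc
    rw [QuotientGroup.mk_mul, (QuotientGroup.eq_one_iff z).2 hz, mul_one]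
    obtain ⟨j, rfl⟩ := hy
    exact ⟨j, rfl⟩
  · rwa [← QuotientGroup.eq_one_iff]
  · rintro ⟨k, rfl⟩
    apply hcb
    rw [← hk]
    show ((c : G ⧸ E) ^ p ^ (r + 1)) ^ ((p : ℤ) * k) = 1
    rw [zpow_mul, zpow_natCast, ← pow_mul, ← pow_succ, (hcE _).2 le_rfl, one_zpow]

/-- Let `p` be odd and `G` a finite `p`-group of order `p^n`, `n > 4`,
containing a cyclic subgroup of index `p^2`, and suppose `G` is not
metacyclic. Then `G/G'` is not cyclic, there is a normal subgroup `A` of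
order `p^3` with `G/A` cyclic, and consequently `|G'|` divides `p^2`. -/
theorem commutator_card_dvd_p_sq
    (p n : ℕ) (hp : p.Prime) (hp2 : 2 < p) (hn : 4 < n)
    (G : Type*) [Group G] [Finite G] (hcard : Nat.card G = p ^ n)
    (C : Subgroup G) (hC : IsCyclic C) (hCi : C.index = p ^ 2)
    (hnm : ¬ IsMetacyclic G) :
    ¬ IsCyclic (G ⧸ commutator G)
    ∧ (∃ A : Subgroup G, ∃ h : A.Normal, Nat.card A = p ^ 3
        ∧ (letI := h; IsCyclic (G ⧸ A)))
    ∧ Nat.card (commutator G) ∣ p ^ 2 := by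
  have hncyc : ¬ IsCyclic (G ⧸ commutator G) := by
    intro h
    have := isCyclic_of_isCyclic_quotient_commutator hp hcard h
    exact hnm ⟨⊤, inferInstance, isCyclic_of_surjective Subgroup.topEquiv.symm
      Subgroup.topEquiv.symm.surjective,
      isCyclic_of_surjective _ (QuotientGroup.mk'_surjective _)⟩
  obtain ⟨r, rfl⟩ : ∃ r, n = r + 5 := ⟨n - 5, by omega⟩
  obtain ⟨c, rfl⟩ := (Subgroup.isCyclic_iff_exists_zpowers_eq_top C).1 hC
  have hc : orderOf c = p ^ (r + 3) := by
    have := (Subgroup.zpowers c).card_mul_index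
    rw [hCi, hcard, Nat.card_zpowers, pow_add p (r + 3) 2] at this
    exact Nat.eq_of_mul_eq_mul_right (pow_pos hp.pos _) this
  obtain ⟨A, hA, hAc, hAq⟩ := exists_normal_card_prime_pow_three hp hp2 hcard hc hnm
  refine ⟨hncyc, ⟨A, hA, hAc, hAq⟩, ?_⟩
  have hder : commutator G ≤ A := Subgroup.Normal.quotient_commutative_iff_commutator_le.1
    IsCyclic.isMulCommutative
  obtain ⟨j, hj, hjc⟩ := (Nat.dvd_prime_pow hp).1 (hAc ▸ Subgroup.card_dvd_of_le hder)
  rw [hjc]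
  apply pow_dvd_pow
  by_contra! hlt
  obtain rfl : j = 3 := by omega
  have heq : commutator G = A := Subgroup.eq_of_le_of_card_ge hder (by rw [hAc, hjc])
  subst heq
  exact hncyc hAq
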